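/- Lemma 2.5: For any family (a_i)_{i∈I} ⊂ ℝ∪{+∞}, the robust sum satisfies: ∑^R_{i∈I} a_i = ∑_{i∈I} a_i^+ if sup_{i∈I} a_i ≥ 0, and ∑^R_{i∈I} a_i = sup_{i∈I} a_i if sup_{i∈I} a_i ≤ 0. -/

import Mathlib

open Filter Topology

noncomputable section

/-- The robust sum `∑^R_{i∈I} a_i := sup_{J ∈ F(I)} ∑_{i∈J} a_i`, where `F(I)` is the
set of nonempty finite subsets of `I`. -/
def rsumE {ι : Type*} (a : ι → EReal) : EReal :=
  ⨆ (J : Finset ι) (_ : J.Nonempty), ∑ i ∈ J, a i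

theorem iSup_le_rsumE {ι : Type*} (a : ι → EReal) : ⨆ i, a i ≤ rsumE a := by
  refine iSup_le fun i => ?_
  have h := le_iSup₂ (f := fun (J : Finset ι) (_ : J.Nonempty) => ∑ i ∈ J, a i)
    {i} (Finset.singleton_nonempty i)
  simpa [rsumE] using h

theorem sum_sup_zero_eq_sum_filter {ι : Type*} (a : ι → EReal) (J : Finset ι) :
    ∑ i ∈ J, (a i ⊔ 0) = ∑ i ∈ J with 0 ≤ a i, a i := by
  rw [Finset.sum_filter]
  refine Finset.sum_congr rfl fun i _ => ?_
  split_ifs with h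
  · exact sup_eq_left.2 h
  · exact sup_eq_right.2 (not_le.1 h).le

/-- Lemma 2.5: `∑^R_{i∈I} a_i = ∑_{i∈I} a_i⁺` (the sum of the nonnegative family
`(a_i⁺)`, i.e. the supremum of its finite partial sums) if `sup_i a_i ≥ 0`, and
`∑^R_{i∈I} a_i = sup_i a_i` if `sup_i a_i ≤ 0`. -/
theorem robust_sum_formula {ι : Type*} [Infinite ι] (a : ι → EReal)
    (ha : ∀ i, a i ≠ ⊥) :
    ((0 ≤ ⨆ i, a i) → rsumE a = ⨆ J : Finset ι, ∑ i ∈ J, (a i ⊔ 0)) ∧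
      ((⨆ i, a i) ≤ 0 → rsumE a = ⨆ i, a i) := by
  refine ⟨fun h => le_antisymm ?_ ?_, fun h => le_antisymm ?_ (iSup_le_rsumE a)⟩
  · exact iSup₂_le fun J _ =>
      (Finset.sum_le_sum fun i _ => le_sup_left).trans
        (le_iSup (fun J : Finset ι => ∑ i ∈ J, (a i ⊔ 0)) J)
  · refine iSup_le fun J => ?_
    rw [sum_sup_zero_eq_sum_filter]
    rcases (J.filter fun i => 0 ≤ a i).eq_empty_or_nonempty with hK | hK
    · rw [hK, Finset.sum_empty]
      exact h.trans (iSup_le_rsumE a)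
    · exact le_iSup₂ (f := fun (J : Finset ι) (_ : J.Nonempty) => ∑ i ∈ J, a i) _ hK
  · classical
    refine iSup₂_le fun J ⟨j, hj⟩ => le_trans ?_ (le_iSup a j)
    rw [← Finset.add_sum_erase J a hj]
    exact add_le_of_nonpos_right (Finset.sum_nonpos fun i _ => (le_iSup a i).trans h)
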